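/- arXiv:2202.02449 — 5 statements merged into one kernel-verified Lean document; each statement's English description precedes it below -/
import Mathlib

section
/- Let (W_i)_{i≥1} be a sequence of uniformly bounded real-valued random variables on a probability space (i.e., there is M > 0 with |W_i| ≤ M almost surely for all i), and set S̄_n = (W_1 + ⋯ + W_n)/n. If E(S̄_n) → μ as n → ∞, and there exist δ > 0 and C > 0 such that Var(S̄_n) ≤ C·n^{−δ} for all n ≥ 1, then S̄_n → μ almost surely as n → ∞. -/
open scoped BigOperators
open Filter MeasureTheory ProbabilityTheory

open Topology in
/-- If the variances of a sequence of random variables are summable, the centered sequence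
converges to zero almost surely. -/
theorem ae_tendsto_sub_integral_of_summable_variance {Ω : Type*} [MeasurableSpace Ω]
    {μ : Measure Ω} [IsFiniteMeasure μ] {X : ℕ → Ω → ℝ} (hX : ∀ n, MemLp (X n) 2 μ)
    (hsum : Summable fun n => variance (X n) μ) :
    ∀ᵐ ω ∂μ, Tendsto (fun n => X n ω - ∫ ω', X n ω' ∂μ) atTop (𝓝 0) := by
  have hmeas : ∀ n, AEMeasurable (fun ω => ‖X n ω - ∫ ω', X n ω' ∂μ‖ₑ ^ 2) μ := fun n =>
    ((hX n).aestronglyMeasurable.aemeasurable.sub_const _).enorm.pow_const 2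
  have hfin : ∫⁻ ω, ∑' n, ‖X n ω - ∫ ω', X n ω' ∂μ‖ₑ ^ 2 ∂μ ≠ ⊤ := by
    rw [lintegral_tsum hmeas]
    have hev : ∀ n, ∫⁻ ω, ‖X n ω - ∫ ω', X n ω' ∂μ‖ₑ ^ 2 ∂μ =
        ENNReal.ofReal (variance (X n) μ) := fun n => (hX n).ofReal_variance_eq.symm
    simp_rw [hev]
    exact hsum.tsum_ofReal_ne_top
  filter_upwards [ae_lt_top' (AEMeasurable.tsum hmeas) hfin] with ω hω
  have h := ENNReal.tendsto_atTop_zero_of_tsum_ne_top hω.ne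
  have h2 := (ENNReal.continuous_rpow_const (y := (2 : ℝ)⁻¹)).tendsto 0 |>.comp h
  rw [ENNReal.zero_rpow_of_pos (by positivity)] at h2
  rw [tendsto_zero_iff_enorm_tendsto_zero]
  refine h2.congr fun n => ?_
  rw [Function.comp_apply, ← ENNReal.rpow_natCast, ← ENNReal.rpow_mul]
  norm_num

/-- Negative powers are summable along the geometric sequence `⌊c ^ n⌋₊`. -/
theorem summable_floor_pow_rpow_neg {c δ : ℝ} (hc : 1 < c) (hδ : 0 < δ) :
    Summable fun n : ℕ => ((⌊c ^ n⌋₊ : ℕ) : ℝ) ^ (-δ) := by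
  have hc0 : 0 < c := zero_lt_one.trans hc
  have hpos : 0 < 1 - c⁻¹ := sub_pos.2 (inv_lt_one_of_one_lt₀ hc)
  have hgeom : Summable fun n : ℕ => (1 - c⁻¹) ^ (-δ) * (c ^ (-δ)) ^ n :=
    (summable_geometric_of_lt_one (Real.rpow_nonneg hc0.le _)
      (Real.rpow_lt_one_of_one_lt_of_neg hc (neg_neg_of_pos hδ))).mul_left _
  refine hgeom.of_nonneg_of_le (fun n => by positivity) fun n => ?_
  calc ((⌊c ^ n⌋₊ : ℕ) : ℝ) ^ (-δ) ≤ ((1 - c⁻¹) * c ^ n) ^ (-δ) :=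
        Real.rpow_le_rpow_of_nonpos (by positivity) (mul_pow_le_nat_floor_pow hc n)
          (neg_nonpos.2 hδ.le)
    _ = (1 - c⁻¹) ^ (-δ) * (c ^ (-δ)) ^ n := by
        rw [Real.mul_rpow hpos.le (by positivity), Real.rpow_pow_comm hc0.le]

/-- the second-moment method. If `(W_i)_{i ≥ 1}` are uniformly bounded random
variables, `S̄_n = (W_1 + ⋯ + W_n)/n`, `E(S̄_n) → μ₀` and `Var(S̄_n) ≤ C·n^{-δ}` for some
`δ, C > 0`, then `S̄_n → μ₀` almost surely. -/
theorem second_moment_method {Ω : Type*} [MeasurableSpace Ω] (μ : Measure Ω)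
    [IsProbabilityMeasure μ] (W : ℕ → Ω → ℝ) (hmeas : ∀ i, Measurable (W i))
    (M : ℝ) (hM : 0 < M) (hbd : ∀ i, ∀ᵐ ω ∂μ, |W i ω| ≤ M)
    (μ₀ : ℝ)
    (hmean : Tendsto (fun n : ℕ => ∫ ω, (∑ i ∈ Finset.Icc 1 n, W i ω) / n ∂μ)
      atTop (nhds μ₀))
    (δ C : ℝ) (hδ : 0 < δ) (hC : 0 < C)
    (hvar : ∀ n : ℕ, 1 ≤ n →
      variance (fun ω => (∑ i ∈ Finset.Icc 1 n, W i ω) / n) μ ≤ C * (n : ℝ) ^ (-δ)) :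
    ∀ᵐ ω ∂μ, Tendsto (fun n : ℕ => (∑ i ∈ Finset.Icc 1 n, W i ω) / n) atTop (nhds μ₀) := by
  have hlp : ∀ n : ℕ, MemLp (fun ω => (∑ i ∈ Finset.Icc 1 n, W i ω) / n) 2 μ := fun n => by
    have hW : ∀ i, MemLp (W i) 2 μ := fun i =>
      MemLp.of_bound (hmeas i).aestronglyMeasurable M (hbd i)
    have h : MemLp (fun ω => ∑ i ∈ Finset.Icc 1 n, W i ω) 2 μ :=
      memLp_finsetSum (Finset.Icc 1 n) fun i _ => hW i
    simpa only [div_eq_mul_inv] using h.mul_const ((n : ℝ)⁻¹)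
  have hsub : ∀ c : ℝ, 1 < c → ∀ᵐ ω ∂μ, Tendsto
      (fun n : ℕ => (∑ i ∈ Finset.Icc 1 ⌊c ^ n⌋₊, W i ω) / (⌊c ^ n⌋₊ : ℕ)) atTop (nhds μ₀) := by
    intro c hc
    have hfloor : Tendsto (fun n : ℕ => ⌊c ^ n⌋₊) atTop atTop :=
      tendsto_nat_floor_atTop.comp (tendsto_pow_atTop_atTop_of_one_lt hc)
    have hsum : Summable fun n : ℕ => variance
        (fun ω => (∑ i ∈ Finset.Icc 1 ⌊c ^ n⌋₊, W i ω) / (⌊c ^ n⌋₊ : ℕ)) μ :=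
      ((summable_floor_pow_rpow_neg hc hδ).mul_left C).of_nonneg_of_le
        (fun n => variance_nonneg _ _)
        fun n => hvar _ (Nat.one_le_floor_iff _ |>.2 (one_le_pow₀ hc.le))
    filter_upwards [ae_tendsto_sub_integral_of_summable_variance (fun n => hlp ⌊c ^ n⌋₊) hsum]
      with ω hω
    simpa using hω.add (hmean.comp hfloor)
  obtain ⟨c, -, hc, hclim⟩ := exists_seq_strictAnti_tendsto (1 : ℝ)
  filter_upwards [ae_all_iff.2 hbd, ae_all_iff.2 fun k => hsub (c k) (hc k)] with ω hW hω
  have hshift : ∀ n : ℕ, 1 ≤ n → (∑ i ∈ Finset.Icc 1 n, (W i ω + M)) / n =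
      (∑ i ∈ Finset.Icc 1 n, W i ω) / n + M := fun n hn => by
    have : (n : ℝ) ≠ 0 := by positivity
    simp only [Finset.sum_add_distrib, Finset.sum_const, Nat.card_Icc, nsmul_eq_mul,
      Nat.add_sub_cancel]
    field_simp
  have hmono : Monotone fun n : ℕ => ∑ i ∈ Finset.Icc 1 n, (W i ω + M) := fun m n hmn =>
    Finset.sum_le_sum_of_subset_of_nonneg (Finset.Icc_subset_Icc_right hmn)
      fun i _ _ => by linarith [neg_le_of_abs_le (hW i)]
  have hlim := tendsto_div_of_monotone_of_tendsto_div_floor_pow _ (μ₀ + M) hmono c hc hclim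
    fun k => ((hω k).add_const M).congr fun n =>
      (hshift _ (Nat.one_le_floor_iff _ |>.2 (one_le_pow₀ (hc k).le))).symm
  have hfinal := hlim.sub_const M
  rw [add_sub_cancel_right] at hfinal
  refine hfinal.congr' ?_
  filter_upwards [eventually_ge_atTop 1] with n hn
  rw [hshift n hn, add_sub_cancel_right]
end

section
/- Fix α ∈ (0,1). There exists a constant B_α > 0 such that for all integers n ≥ 1, all integers d with 1 ≤ d ≤ n, and every r ∈ {0, 1, …, d−1}, one has |∑_{0 ≤ l ≤ n, l ≡ r (mod d)} binom(n,l)·α^l·(1−α)^{n−l} − 1/d| ≤ B_α/√n. -/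
open scoped BigOperators

/-- A telescoping bound for a Cauchy-type sum. -/
lemma sum_one_div_one_add_sq_le {a : ℝ} (ha : 0 < a) (N : ℕ) :
    ∑ j ∈ Finset.range N, 1 / (1 + (a * (j + 1)) ^ 2) ≤ 2 / a := by
  have key : ∑ j ∈ Finset.range N, 1 / (1 + (a * (j + 1)) ^ 2) ≤
      2 / a * (1 - 1 / (1 + a * N)) := by
    induction N with
    | zero => simp
    | succ N ih =>
      rw [Finset.sum_range_succ]
      have hN : (0 : ℝ) ≤ a * N := by positivity
      have hstep : 1 / (1 + (a * (N + 1)) ^ 2) ≤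
          2 / a * (1 / (1 + a * N) - 1 / (1 + a * (N + 1))) := by
        have h : 2 / a * (1 / (1 + a * N) - 1 / (1 + a * (N + 1))) =
            2 / ((1 + a * N) * (1 + a * (N + 1))) := by
          field_simp
          ring
        rw [h, div_le_div_iff₀ (by positivity) (by positivity)]
        nlinarith [sq_nonneg (a * (N + 1) - 1)]
      push_cast
      linarith
  refine key.trans (mul_le_of_le_one_right (by positivity) ?_)
  have : 0 ≤ 1 / (1 + a * N) := by positivity
  linarith

/-- The squared modulus of the characteristic function of a Bernoulli variable. -/
lemma norm_sq_bernoulli_char (α θ : ℝ) :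
    ‖(α : ℂ) * Complex.exp (θ * Complex.I) + (1 - α)‖ ^ 2 =
      1 - 4 * (α * (1 - α)) * Real.sin (θ / 2) ^ 2 := by
  have hcos : Real.cos θ = 1 - 2 * Real.sin (θ / 2) ^ 2 := by
    have h := Real.cos_two_mul (θ / 2)
    rw [mul_div_cancel₀ θ two_ne_zero] at h
    nlinarith [Real.sin_sq_add_cos_sq (θ / 2)]
  have hre : ((α : ℂ) * Complex.exp (θ * Complex.I) + (1 - α)).re =
      α * Real.cos θ + (1 - α) := by
    simp [Complex.exp_ofReal_mul_I_re]
  have him : ((α : ℂ) * Complex.exp (θ * Complex.I) + (1 - α)).im = α * Real.sin θ := by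
    simp [Complex.exp_ofReal_mul_I_im]
  rw [← Complex.normSq_eq_norm_sq, Complex.normSq_apply, hre, him]
  have := Real.sin_sq_add_cos_sq θ
  linear_combination α ^ 2 * this + 2 * α * (1 - α) * hcos

lemma norm_bernoulli_char_pow_le {α : ℝ} (hα : α ∈ Set.Ioo (0 : ℝ) 1) (θ : ℝ) (n : ℕ)
    {t : ℝ} (ht : t ≤ Real.sin (θ / 2) ^ 2) (ht0 : 0 ≤ t) :
    ‖(α : ℂ) * Complex.exp (θ * Complex.I) + (1 - α)‖ ^ n ≤
      1 / (1 + 2 * (α * (1 - α)) * n * t) := by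
  have hp : 0 < α * (1 - α) := mul_pos hα.1 (sub_pos.2 hα.2)
  have hsq : ‖(α : ℂ) * Complex.exp (θ * Complex.I) + (1 - α)‖ ^ 2 ≤
      Real.exp (-(2 * (α * (1 - α)) * t)) ^ 2 := by
    rw [norm_sq_bernoulli_char, ← Real.exp_nat_mul]
    have h1 := Real.add_one_le_exp (((2 : ℕ) : ℝ) * -(2 * (α * (1 - α)) * t))
    push_cast at h1 ⊢
    nlinarith [mul_le_mul_of_nonneg_left ht hp.le]
  have hle := (pow_le_pow_iff_left₀ (norm_nonneg _) (Real.exp_pos _).le two_ne_zero).1 hsq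
  calc _ ≤ Real.exp (-(2 * (α * (1 - α)) * t)) ^ n := by gcongr
    _ = (Real.exp (2 * (α * (1 - α)) * n * t))⁻¹ := by
      rw [← Real.exp_nat_mul, ← Real.exp_neg]; ring_nf
    _ ≤ _ := by
      rw [← one_div]
      apply one_div_le_one_div_of_le (by positivity)
      linarith [Real.add_one_le_exp (2 * (α * (1 - α)) * n * t)]

/-- Jordan's inequality at `π * j / d`, in a form symmetric under `j ↦ d - j`. -/
lemma min_sq_le_sin_sq {d j : ℕ} (hj : j ≤ d) (hd : 0 < d) :
    (2 * (min j (d - j) : ℕ) / d : ℝ) ^ 2 ≤ Real.sin (Real.pi * j / d) ^ 2 := by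
  have jordan : ∀ k : ℕ, 2 * k ≤ d → (2 * k / d : ℝ) ^ 2 ≤ Real.sin (Real.pi * k / d) ^ 2 := by
    intro k hk
    have hd' : (0 : ℝ) < d := by exact_mod_cast hd
    have hk' : (2 * k : ℝ) ≤ d := by exact_mod_cast hk
    have h := Real.mul_le_sin (x := Real.pi * k / d) (by positivity) (by
      rw [div_le_div_iff₀ hd' two_pos]
      nlinarith [Real.pi_pos])
    have he : 2 / Real.pi * (Real.pi * k / d) = 2 * k / d := by
      field_simp
    rw [he] at h
    gcongr
  rcases le_total j (d - j) with h | h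
  · rw [min_eq_left h]
    exact jordan j (by omega)
  · rw [min_eq_right h]
    have hs : Real.sin (Real.pi * j / d) = Real.sin (Real.pi * (d - j : ℕ) / d) := by
      rw [← Real.sin_pi_sub]
      congr 1
      push_cast [hj]
      field_simp
    rw [hs]
    exact jordan _ (by omega)

lemma IsPrimitiveRoot.sum_pow_pow_eq {ζ : ℂ} {d : ℕ} (hζ : IsPrimitiveRoot ζ d) (k : ℕ) :
    ∑ j ∈ Finset.range d, (ζ ^ k) ^ j = if d ∣ k then (d : ℂ) else 0 := by
  split_ifs with h
  · simp [(hζ.pow_eq_one_iff_dvd k).2 h]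
  · have h1 : ζ ^ k ≠ 1 := fun h' => h ((hζ.pow_eq_one_iff_dvd k).1 h')
    rw [geom_sum_eq h1, ← pow_mul, mul_comm, pow_mul, hζ.pow_eq_one]
    simp

/-- The roots of unity filter applied to the binomial expansion. -/
lemma IsPrimitiveRoot.mul_sum_filter_mod {ζ : ℂ} {d r : ℕ} (hζ : IsPrimitiveRoot ζ d)
    (hr : r < d) (x y : ℂ) (n : ℕ) :
    (d : ℂ) * ∑ l ∈ (Finset.range (n + 1)).filter (fun l => l % d = r),
        (n.choose l : ℂ) * x ^ l * y ^ (n - l) =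
      ∑ j ∈ Finset.range d, (ζ ^ j) ^ (d - r) * (x * ζ ^ j + y) ^ n := by
  simp_rw [add_pow, Finset.mul_sum]
  rw [Finset.sum_comm, Finset.sum_filter]
  refine Finset.sum_congr rfl fun l _ => ?_
  have hdvd : d ∣ l + (d - r) ↔ l % d = r := by
    rw [← Nat.modEq_zero_iff_dvd]
    constructor
    · intro h
      have h2 : l + (d - r) + r ≡ 0 + r [MOD d] := h.add_right r
      rw [show l + (d - r) + r = l + d by omega, zero_add] at h2
      simpa [Nat.ModEq, Nat.mod_eq_of_lt hr] using h2
    · intro h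
      apply Nat.ModEq.add_right_cancel' r
      rw [show l + (d - r) + r = l + d by omega, zero_add]
      simpa [Nat.ModEq, Nat.mod_eq_of_lt hr] using h
  have hsum := hζ.sum_pow_pow_eq (l + (d - r))
  calc _ = (∑ j ∈ Finset.range d, (ζ ^ (l + (d - r))) ^ j) *
        ((n.choose l : ℂ) * x ^ l * y ^ (n - l)) := by
        rw [hsum]
        simp only [hdvd]
        split_ifs <;> simp
    _ = _ := by
        rw [Finset.sum_mul]
        refine Finset.sum_congr rfl fun j _ => ?_
        rw [mul_pow]
        ring

/-- Fix α ∈ (0,1). There exists a constant B_α > 0 such that for all integers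
n ≥ 1, all integers d with 1 ≤ d ≤ n, and every r ∈ {0, 1, …, d−1}, one has
|∑_{0 ≤ l ≤ n, l ≡ r (mod d)} binom(n,l)·α^l·(1−α)^{n−l} − 1/d| ≤ B_α/√n. -/
theorem binomial_sum_mod_bound (α : ℝ) (hα : α ∈ Set.Ioo (0 : ℝ) 1) :
    ∃ B : ℝ, 0 < B ∧ ∀ n : ℕ, 1 ≤ n → ∀ d : ℕ, 1 ≤ d → d ≤ n → ∀ r : ℕ, r < d →
      |(∑ l ∈ (Finset.range (n + 1)).filter (fun l => l % d = r),
          (n.choose l : ℝ) * α ^ l * (1 - α) ^ (n - l)) - 1 / d| ≤ B / Real.sqrt n := by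
  have hp : 0 < α * (1 - α) := mul_pos hα.1 (sub_pos.2 hα.2)
  refine ⟨4 / Real.sqrt (8 * (α * (1 - α))), by positivity, ?_⟩
  intro n hn d hd _ r hr
  have hd0 : (0 : ℝ) < d := by exact_mod_cast hd
  have hn0 : (0 : ℝ) < n := by exact_mod_cast hn
  set a : ℝ := Real.sqrt (8 * (α * (1 - α))) * Real.sqrt n / d with ha_def
  have ha : 0 < a := by positivity
  have ha2 : a ^ 2 = 8 * (α * (1 - α)) * n / d ^ 2 := by
    rw [ha_def, div_pow, mul_pow, Real.sq_sqrt (by positivity), Real.sq_sqrt hn0.le]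
  set ζ : ℂ := Complex.exp (2 * Real.pi * Complex.I / d)
  have hζ : IsPrimitiveRoot ζ d := Complex.isPrimitiveRoot_exp d (by omega)
  set S : ℝ := ∑ l ∈ (Finset.range (n + 1)).filter (fun l => l % d = r),
      (n.choose l : ℝ) * α ^ l * (1 - α) ^ (n - l) with hS
  have hfilter := hζ.mul_sum_filter_mod hr (α : ℂ) (1 - α) n
  obtain ⟨m, rfl⟩ : ∃ m, d = m + 1 := ⟨d - 1, by omega⟩
  rw [Finset.sum_range_succ'] at hfilter
  have hterm : ∀ j ∈ Finset.range m,
      ‖(ζ ^ (j + 1)) ^ (m + 1 - r) * ((α : ℂ) * ζ ^ (j + 1) + (1 - α)) ^ n‖ ≤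
        1 / (1 + (a * (j + 1)) ^ 2) + 1 / (1 + (a * ((m - 1 - j : ℕ) + 1)) ^ 2) := by
    intro j hj
    have hjm := Finset.mem_range.1 hj
    have hζj : ζ ^ (j + 1) =
        Complex.exp ((2 * (Real.pi * (j + 1 : ℕ) / (m + 1 : ℕ)) : ℝ) * Complex.I) := by
      rw [← Complex.exp_nat_mul]
      congr 1
      push_cast
      ring
    have hb := norm_bernoulli_char_pow_le hα
      (2 * (Real.pi * (j + 1 : ℕ) / (m + 1 : ℕ))) n
      (t := (2 * (min (j + 1) (m + 1 - (j + 1)) : ℕ) / (m + 1 : ℕ) : ℝ) ^ 2) (by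
        rw [mul_div_cancel_left₀ _ two_ne_zero]
        exact min_sq_le_sin_sq (d := m + 1) (j := j + 1) (by omega) (by omega)) (sq_nonneg _)
    rw [norm_mul, norm_pow, norm_pow, hζ.norm'_eq_one (by omega), one_pow, one_pow, one_mul,
      norm_pow, hζj]
    refine hb.trans ?_
    have hrew : ∀ k : ℕ, 2 * (α * (1 - α)) * n * (2 * (k : ℝ) / (m + 1 : ℕ)) ^ 2 =
        (a * k) ^ 2 := by
      intro k
      rw [mul_pow a, ha2]
      field_simp
      ring
    rw [hrew]
    rcases min_choice (j + 1) (m + 1 - (j + 1)) with h | h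
    · rw [h]
      push_cast
      exact le_add_of_nonneg_right (by positivity)
    · rw [h, show m + 1 - (j + 1) = m - 1 - j + 1 by omega, Nat.cast_add_one]
      exact le_add_of_nonneg_left (by positivity)
  have hbound : ∑ j ∈ Finset.range m, (1 / (1 + (a * (j + 1)) ^ 2) +
      1 / (1 + (a * ((m - 1 - j : ℕ) + 1)) ^ 2)) ≤ 4 / a := by
    rw [Finset.sum_add_distrib,
      Finset.sum_range_reflect (fun j : ℕ => 1 / (1 + (a * (j + 1)) ^ 2)) m]
    have := sum_one_div_one_add_sq_le ha m
    calc _ ≤ 2 / a + 2 / a := add_le_add this this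
      _ = 4 / a := by ring
  have hnorm := (norm_sum_le _ _).trans ((Finset.sum_le_sum hterm).trans hbound)
  have hcast : ((((m + 1 : ℕ) : ℝ) * S - 1 : ℝ) : ℂ) = ∑ j ∈ Finset.range m,
      (ζ ^ (j + 1)) ^ (m + 1 - r) * ((α : ℂ) * ζ ^ (j + 1) + (1 - α)) ^ n := by
    simp only [pow_zero, one_pow, mul_one, add_sub_cancel] at hfilter
    rw [eq_sub_of_add_eq hfilter.symm, hS]
    push_cast
    rfl
  rw [← hcast, Complex.norm_real, Real.norm_eq_abs] at hnorm
  have hS' : S - 1 / (m + 1 : ℕ) = (((m + 1 : ℕ) : ℝ) * S - 1) / (m + 1 : ℕ) := by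
    field_simp
  rw [hS', abs_div, abs_of_pos hd0, div_le_iff₀ hd0]
  refine hnorm.trans (le_of_eq ?_)
  rw [ha_def]
  field_simp
end

section
/- Fix an integer k ≥ 1. For every ε > 0 there is a constant C = C(k,ε) > 0 such that for all integers N ≥ 1, |∑_{1 ≤ n ≤ N} f_k(n)·f_k(n+1) − N·∏_p (1 − 2/p^{2k})| ≤ C·N^{ε}, where the product is over all primes p. -/
open scoped BigOperators Classical

/-- A positive integer `m` is `k`-free if `p ^ k` does not divide `m` for every prime `p`. -/
def KFree (k m : ℕ) : Prop := ∀ p : ℕ, p.Prime → ¬ p ^ k ∣ m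

/-- `f k n = ∑ μ(r)/(r·d)` over pairs `(r, d)` of positive integers with `r * d ∣ n`
and `d` k-free. -/
noncomputable def ffun (k n : ℕ) : ℝ :=
  ∑ w ∈ n.divisors, ∑ rd ∈ w.divisorsAntidiagonal,
    if KFree k rd.2 then (ArithmeticFunction.moebius rd.1 : ℝ) / ((rd.1 : ℝ) * (rd.2 : ℝ))
    else 0

open ArithmeticFunction (moebius)

/-- The Dirichlet coefficients of `1 / ζ(k s)`: the value at `m ^ k` is `μ m`, and the value is `0`
away from `k`-th powers. -/
noncomputable def moebiusRoot (k w : ℕ) : ℝ :=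
  ∑ m ∈ Finset.Icc 1 w, if m ^ k = w then (moebius m : ℝ) else 0

theorem sum_divisors_mul_moebiusRoot {k : ℕ} (hk : k ≠ 0) {n M : ℕ} (hn : n ≠ 0) (hM : n ≤ M)
    (φ : ℕ → ℝ) :
    ∑ w ∈ n.divisors, φ w * moebiusRoot k w =
      ∑ m ∈ Finset.Icc 1 M, if m ^ k ∣ n then φ (m ^ k) * (moebius m : ℝ) else 0 := by
  have h1 : ∀ w ∈ n.divisors, φ w * moebiusRoot k w =
      ∑ m ∈ Finset.Icc 1 M, if m ^ k = w then φ w * (moebius m : ℝ) else 0 := by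
    intro w hw
    have hw' := Nat.mem_divisors.1 hw
    have hwn := Nat.le_of_dvd (Nat.pos_of_ne_zero hn) hw'.1
    rw [moebiusRoot, Finset.mul_sum, ← Finset.sum_subset
      (Finset.Icc_subset_Icc_right (hwn.trans hM))]
    · simp only [mul_ite, mul_zero]
    · intro m hm hm'
      simp only [Finset.mem_Icc] at hm hm'
      have : m ≤ m ^ k := Nat.le_self_pow hk m
      rw [if_neg]
      omega
  rw [Finset.sum_congr rfl h1, Finset.sum_comm]
  refine Finset.sum_congr rfl fun m _ => ?_
  rw [Finset.sum_ite_eq]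
  simp [hn]

theorem sum_divisors_moebius (n : ℕ) :
    ∑ d ∈ n.divisors, (moebius d : ℝ) = if n = 1 then 1 else 0 := by
  have h := congrArg (fun f : ArithmeticFunction ℤ => f n)
    ArithmeticFunction.coe_zeta_mul_moebius
  simp only [ArithmeticFunction.coe_zeta_mul_apply, ArithmeticFunction.one_apply] at h
  exact_mod_cast h

theorem kFree_iff_floorRoot_eq_one {k n : ℕ} : KFree k n ↔ k.floorRoot n = 1 := by
  simp only [KFree, Nat.pow_dvd_iff_dvd_floorRoot, Nat.eq_one_iff_not_exists_prime_dvd]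

theorem sum_divisors_moebiusRoot {k n : ℕ} (hk : k ≠ 0) (hn : n ≠ 0) :
    ∑ w ∈ n.divisors, moebiusRoot k w = if KFree k n then 1 else 0 := by
  have h := sum_divisors_mul_moebiusRoot hk hn le_rfl (fun _ => 1)
  simp only [one_mul] at h
  rw [h, ← Finset.sum_filter]
  have h2 : (Finset.Icc 1 n).filter (fun m => m ^ k ∣ n) = (k.floorRoot n).divisors := by
    ext m
    simp only [Finset.mem_filter, Finset.mem_Icc, Nat.mem_divisors, Nat.pow_dvd_iff_dvd_floorRoot]
    constructor
    · rintro ⟨_, h⟩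
      exact ⟨h, Nat.floorRoot_ne_zero.2 ⟨hk, hn⟩⟩
    · rintro ⟨h, h0⟩
      refine ⟨⟨Nat.pos_of_dvd_of_pos h (Nat.pos_of_ne_zero h0), ?_⟩, h⟩
      exact (Nat.le_self_pow hk m).trans
        (Nat.le_of_dvd (Nat.pos_of_ne_zero hn) (Nat.pow_dvd_iff_dvd_floorRoot.2 h))
  rw [h2, sum_divisors_moebius]
  simp only [kFree_iff_floorRoot_eq_one]

/-- `ffun k n` is the sum of `μ m / m ^ k` over the `m` with `m ^ k ∣ n`. -/
theorem ffun_eq_sum_Icc {k n M : ℕ} (hk : k ≠ 0) (hn : n ≠ 0) (hM : n ≤ M) :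
    ffun k n = ∑ m ∈ Finset.Icc 1 M, if m ^ k ∣ n then (moebius m : ℝ) / (m : ℝ) ^ k else 0 := by
  have hinv := (ArithmeticFunction.sum_eq_iff_sum_mul_moebius_eq (f := moebiusRoot k)
    (g := fun n => if KFree k n then (1 : ℝ) else 0)).1
    fun n hn => sum_divisors_moebiusRoot hk hn.ne'
  have h1 : ffun k n = ∑ w ∈ n.divisors, (w : ℝ)⁻¹ * moebiusRoot k w := by
    refine Finset.sum_congr rfl fun w hw => ?_
    rw [← hinv w (Nat.pos_of_mem_divisors hw), Finset.mul_sum]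
    refine Finset.sum_congr rfl fun rd hrd => ?_
    rw [← (Nat.mem_divisorsAntidiagonal.1 hrd).1]
    split_ifs <;> push_cast <;> ring
  rw [h1, sum_divisors_mul_moebiusRoot hk hn hM]
  refine Finset.sum_congr rfl fun m _ => ?_
  push_cast
  split_ifs <;> ring

theorem abs_card_filter_dvd_dvd_succ_sub_le {A B : ℕ} (hA : A ≠ 0) (hB : B ≠ 0)
    (h : A.Coprime B) (N : ℕ) :
    |(((Finset.Icc 1 N).filter fun n => A ∣ n ∧ B ∣ n + 1).card : ℝ) - N / (A * B)| ≤ 1 := by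
  obtain ⟨c, hc1, hc2⟩ := Nat.chineseRemainder h 0 (B - 1)
  have hr : 0 < A * B := Nat.mul_pos (Nat.pos_of_ne_zero hA) (Nat.pos_of_ne_zero hB)
  have hset : ((Finset.Icc 1 N).filter fun n => A ∣ n ∧ B ∣ n + 1) =
      (Finset.Ioc 0 N).filter (fun n => n ≡ c [MOD A * B]) := by
    ext n
    simp only [Finset.mem_filter, Finset.mem_Icc, Finset.mem_Ioc, Nat.succ_le_iff,
      ← Nat.modEq_and_modEq_iff_modEq_mul h]
    refine and_congr_right fun _ => and_congr ?_ ?_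
    · rw [← Nat.modEq_zero_iff_dvd]
      exact ⟨fun h => h.trans hc1.symm, fun h => h.trans hc1⟩
    · have h3 : n ≡ c [MOD B] ↔ n + 1 ≡ (B - 1) + 1 [MOD B] :=
        ⟨fun h => (h.trans hc2).add_right 1,
          fun h => (Nat.ModEq.add_right_cancel' 1 h).trans hc2.symm⟩
      rw [h3, Nat.sub_add_cancel (Nat.pos_of_ne_zero hB), ← Nat.modEq_zero_iff_dvd]
      have : B ≡ 0 [MOD B] := by simp [Nat.ModEq]
      exact ⟨fun h => h.trans this.symm, fun h => h.trans this⟩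
  have hcard := Nat.Ioc_filter_modEq_card 0 N hr c
  rw [← hset] at hcard
  have hrR : (0 : ℚ) < A * B := by exact_mod_cast hr
  set q : ℕ := ((Finset.Icc 1 N).filter fun n => A ∣ n ∧ B ∣ n + 1).card
  push_cast at hcard
  set x : ℚ := (N - c) / (A * B)
  set y : ℚ := (0 - c) / (A * B)
  have hxy : x - y = N / (A * B) := by simp only [x, y]; ring
  have hle : ⌊y⌋ ≤ ⌊x⌋ := by
    apply Int.floor_le_floor
    have : (0 : ℚ) ≤ N / (A * B) := by positivity
    linarith
  rw [max_eq_left (by omega)] at hcard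
  have hq : (q : ℚ) = ⌊x⌋ - ⌊y⌋ := by exact_mod_cast hcard
  have key : |(q : ℚ) - N / (A * B)| ≤ 1 := by
    rw [← hxy, hq, abs_le]
    have := Int.floor_le x
    have := Int.floor_le y
    have := Int.lt_floor_add_one x
    have := Int.lt_floor_add_one y
    constructor <;> linarith
  have key' : |((q : ℚ) : ℝ) - ((N / (A * B) : ℚ) : ℝ)| ≤ 1 := by exact_mod_cast key
  push_cast at key'
  exact key'

theorem filter_dvd_dvd_succ_eq_empty {A B : ℕ} (h : ¬ A.Coprime B) (s : Finset ℕ) :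
    (s.filter fun n => A ∣ n ∧ B ∣ n + 1) = ∅ := by
  refine Finset.filter_eq_empty_iff.2 fun n _ ⟨h1, h2⟩ => h ?_
  exact Nat.Coprime.of_dvd h1 h2 (by simp)

/-- The summand of the double series `∑ μ(a) μ(b) / (a b) ^ (2 k)` over coprime pairs. -/
noncomputable def coprimeTerm (k : ℕ) (p : ℕ × ℕ) : ℝ :=
  if p.1.Coprime p.2 then
    (moebius p.1 : ℝ) * (moebius p.2 : ℝ) / ((p.1 : ℝ) * (p.2 : ℝ)) ^ (2 * k)
  else 0

theorem abs_moebius_le_one_real (n : ℕ) : |(moebius n : ℝ)| ≤ 1 := by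
  exact_mod_cast ArithmeticFunction.abs_moebius_le_one (n := n)

theorem abs_coprimeTerm_le {k : ℕ} (hk : 1 ≤ k) (p : ℕ × ℕ) :
    |coprimeTerm k p| ≤ ((p.1 : ℝ) ^ 2)⁻¹ * ((p.2 : ℝ) ^ 2)⁻¹ := by
  have hnn : 0 ≤ ((p.1 : ℝ) ^ 2)⁻¹ * ((p.2 : ℝ) ^ 2)⁻¹ := by positivity
  rw [coprimeTerm]
  split_ifs
  · rcases Nat.eq_zero_or_pos p.1 with h1 | h1
    · simp [h1]
    rcases Nat.eq_zero_or_pos p.2 with h2 | h2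
    · simp [h2]
    rw [abs_div, abs_mul, ← mul_inv, ← mul_pow, inv_eq_one_div]
    have h3 : (1 : ℝ) ≤ (p.1 : ℝ) * p.2 := by exact_mod_cast Nat.mul_pos h1 h2
    have h4 : ((p.1 : ℝ) * p.2) ^ 2 ≤ |((p.1 : ℝ) * p.2) ^ (2 * k)| := by
      rw [abs_of_pos (by positivity)]
      exact pow_le_pow_right₀ h3 (by omega)
    refine div_le_div₀ zero_le_one ?_ (by positivity) h4
    exact mul_le_one₀ (abs_moebius_le_one_real _) (abs_nonneg _) (abs_moebius_le_one_real _)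
  · simpa using hnn

theorem summable_inv_sq : Summable fun n : ℕ => ((n : ℝ) ^ 2)⁻¹ :=
  Real.summable_nat_pow_inv.2 one_lt_two

theorem summable_inv_sq_mul_inv_sq :
    Summable fun p : ℕ × ℕ => ((p.1 : ℝ) ^ 2)⁻¹ * ((p.2 : ℝ) ^ 2)⁻¹ :=
  summable_inv_sq.mul_of_nonneg summable_inv_sq (fun n => by positivity) (fun n => by positivity)

theorem summable_coprimeTerm {k : ℕ} (hk : 1 ≤ k) : Summable (coprimeTerm k) :=
  Summable.of_norm_bounded summable_inv_sq_mul_inv_sq (abs_coprimeTerm_le hk)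

theorem sum_divisorsAntidiagonal_coprimeTerm (k n : ℕ) :
    ∑ p ∈ n.divisorsAntidiagonal, coprimeTerm k p =
      (moebius n : ℝ) * n.divisors.card / (n : ℝ) ^ (2 * k) := by
  by_cases hn : Squarefree n
  · have h : ∀ p ∈ n.divisorsAntidiagonal,
        coprimeTerm k p = (moebius n : ℝ) / (n : ℝ) ^ (2 * k) := by
      intro p hp
      obtain ⟨rfl, -⟩ := Nat.mem_divisorsAntidiagonal.1 hp
      have hc := Nat.coprime_of_squarefree_mul hn
      rw [coprimeTerm, if_pos hc,
        ArithmeticFunction.isMultiplicative_moebius.map_mul_of_coprime hc]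
      push_cast
      rfl
    rw [Finset.sum_congr rfl h, Finset.sum_const, ← Nat.map_div_right_divisors, Finset.card_map,
      nsmul_eq_mul]
    ring
  · rw [ArithmeticFunction.moebius_eq_zero_of_not_squarefree hn]
    simp only [Int.cast_zero, zero_mul, zero_div]
    refine Finset.sum_eq_zero fun p hp => ?_
    obtain ⟨rfl, -⟩ := Nat.mem_divisorsAntidiagonal.1 hp
    rw [coprimeTerm]
    split_ifs with hc
    · rw [← Int.cast_mul, ← ArithmeticFunction.isMultiplicative_moebius.map_mul_of_coprime hc,
        ArithmeticFunction.moebius_eq_zero_of_not_squarefree hn]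
      simp
    · rfl

theorem tsum_fiber_coprimeTerm (k n : ℕ) :
    ∑' p : ((fun p : ℕ × ℕ => p.1 * p.2) ⁻¹' {n}), coprimeTerm k p =
      ∑ p ∈ n.divisorsAntidiagonal, coprimeTerm k p := by
  rcases eq_or_ne n 0 with rfl | hn
  · rw [Nat.divisorsAntidiagonal_zero, Finset.sum_empty]
    convert tsum_zero with p
    rcases Nat.mul_eq_zero.1 p.2 with h | h <;> simp [coprimeTerm, h]
  · have : ((fun p : ℕ × ℕ => p.1 * p.2) ⁻¹' {n}) = ↑n.divisorsAntidiagonal := by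
      ext p
      simp [hn]
    rw [this]
    exact Finset.tsum_subtype' _ (coprimeTerm k)

theorem tsum_coprimeTerm {k : ℕ} (hk : 1 ≤ k) :
    ∑' p, coprimeTerm k p = ∏' p : Nat.Primes, (1 - 2 / ((p : ℕ) : ℝ) ^ (2 * k)) := by
  set G : ℕ → ℝ := fun n => (moebius n : ℝ) * n.divisors.card / (n : ℝ) ^ (2 * k) with hG
  have hsum : HasSum G (∑' p, coprimeTerm k p) := by
    have h := (summable_coprimeTerm hk).hasSum.tsum_fiberwise (fun p : ℕ × ℕ => p.1 * p.2)
    refine h.congr_fun fun n => ?_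
    rw [tsum_fiber_coprimeTerm, sum_divisorsAntidiagonal_coprimeTerm]
  have habs : Summable fun n => ‖G n‖ := hsum.summable.norm
  have hprod := EulerProduct.eulerProduct_hasProd (f := G) (by simp [hG]) (by
    intro m n hmn
    simp only [hG]
    rw [ArithmeticFunction.isMultiplicative_moebius.map_mul_of_coprime hmn,
      Nat.Coprime.card_divisors_mul hmn]
    push_cast
    ring) habs (by simp [hG])
  rw [hsum.tsum_eq] at hprod
  rw [← hprod.tprod_eq]
  congr 1
  ext p
  rw [tsum_eq_sum (s := Finset.range 2)]
  · simp [Finset.sum_range_succ, hG, ArithmeticFunction.moebius_apply_prime p.2, p.2.divisors,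
      Finset.card_pair p.2.one_lt.ne]
    ring
  · intro e he
    simp only [Finset.mem_range, not_lt] at he
    simp only [hG]
    rw [ArithmeticFunction.moebius_apply_prime_pow p.2 (by omega), if_neg (by omega)]
    simp

theorem tsum_inv_sq_sub_sum_le {M : ℕ} (hM : M ≠ 0) :
    ∑' n : ℕ, ((n : ℝ) ^ 2)⁻¹ - ∑ n ∈ Finset.Icc 1 M, ((n : ℝ) ^ 2)⁻¹ ≤ (M : ℝ)⁻¹ := by
  rw [sub_le_iff_le_add]
  refine Real.tsum_le_of_sum_range_le (fun n => by positivity) fun n => ?_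
  have h1 : ∑ i ∈ Finset.range n, ((i : ℝ) ^ 2)⁻¹ ≤
      ∑ i ∈ Finset.Icc 1 (n + M), ((i : ℝ) ^ 2)⁻¹ := by
    rw [← Finset.sum_filter_ne_zero]
    refine Finset.sum_le_sum_of_subset_of_nonneg ?_ fun i _ _ => by positivity
    intro i hi
    simp only [Finset.mem_filter, Finset.mem_range, Finset.mem_Icc] at hi ⊢
    have : i ≠ 0 := by rintro rfl; simp at hi
    omega
  have h2 : Finset.Icc 1 (n + M) = Finset.Icc 1 M ∪ Finset.Ioc M (n + M) := by
    ext i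
    simp only [Finset.mem_Icc, Finset.mem_union, Finset.mem_Ioc]
    omega
  have h3 := sum_Ioc_inv_sq_le_sub (α := ℝ) hM (Nat.le_add_left M n)
  have h4 : (0 : ℝ) ≤ ((n + M : ℕ) : ℝ)⁻¹ := by positivity
  rw [h2, Finset.sum_union] at h1
  · linarith
  · rw [Finset.disjoint_left]
    intro i
    simp only [Finset.mem_Icc, Finset.mem_Ioc]
    omega

theorem abs_tsum_coprimeTerm_sub_sum_le {k M : ℕ} (hk : 1 ≤ k) (hM : M ≠ 0) :
    |∑' p, coprimeTerm k p - ∑ p ∈ Finset.Icc 1 M ×ˢ Finset.Icc 1 M, coprimeTerm k p| ≤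
      2 * (∑' n : ℕ, ((n : ℝ) ^ 2)⁻¹) * (M : ℝ)⁻¹ := by
  set s := Finset.Icc 1 M ×ˢ Finset.Icc 1 M
  set Z := ∑' n : ℕ, ((n : ℝ) ^ 2)⁻¹
  set z := ∑ n ∈ Finset.Icc 1 M, ((n : ℝ) ^ 2)⁻¹
  have hF := (summable_coprimeTerm hk).sum_add_tsum_compl (s := s)
  have hU := summable_inv_sq_mul_inv_sq.sum_add_tsum_compl (s := s)
  rw [← summable_inv_sq.tsum_mul_tsum summable_inv_sq summable_inv_sq_mul_inv_sq,
    Finset.sum_product] at hU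
  simp only [← Finset.sum_mul_sum] at hU
  have hle : |∑' p : ((s : Set (ℕ × ℕ))ᶜ : Set (ℕ × ℕ)), coprimeTerm k p| ≤ Z * Z - z * z := by
    rw [← hU, add_sub_cancel_left]
    exact tsum_of_norm_bounded (f := fun p : ((s : Set (ℕ × ℕ))ᶜ : Set (ℕ × ℕ)) => coprimeTerm k p)
      (summable_inv_sq_mul_inv_sq.subtype _).hasSum fun p => abs_coprimeTerm_le hk p.1
  rw [← hF, add_sub_cancel_left]
  refine hle.trans ?_
  have hz : 0 ≤ z := Finset.sum_nonneg fun i _ => by positivity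
  have hzZ : z ≤ Z := summable_inv_sq.sum_le_tsum _ fun i _ => by positivity
  have ht : Z - z ≤ (M : ℝ)⁻¹ := tsum_inv_sq_sub_sum_le hM
  have hM' : (0 : ℝ) ≤ (M : ℝ)⁻¹ := by positivity
  nlinarith

theorem sum_Icc_inv_eq_harmonic (M : ℕ) :
    ∑ a ∈ Finset.Icc 1 M, (a : ℝ)⁻¹ = (harmonic M : ℝ) := by
  rw [harmonic_eq_sum_Icc]
  push_cast
  rfl

theorem harmonic_succ_le_rpow {δ : ℝ} (hδ : 0 < δ) {N : ℕ} (hN : 1 ≤ N) :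
    (harmonic (N + 1) : ℝ) ≤ (1 + 2 ^ δ / δ) * (N : ℝ) ^ δ := by
  have hN' : (1 : ℝ) ≤ N := by exact_mod_cast hN
  have h1 := harmonic_le_one_add_log (N + 1)
  have h2 : Real.log ((N + 1 : ℕ) : ℝ) ≤ ((N + 1 : ℕ) : ℝ) ^ δ / δ :=
    Real.log_le_rpow_div (by positivity) hδ
  have h3 : ((N + 1 : ℕ) : ℝ) ^ δ ≤ 2 ^ δ * (N : ℝ) ^ δ := by
    rw [← Real.mul_rpow (by norm_num) (by positivity)]
    refine Real.rpow_le_rpow (by positivity) ?_ hδ.le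
    push_cast
    linarith
  have h4 : (1 : ℝ) ≤ (N : ℝ) ^ δ := Real.one_le_rpow hN' hδ.le
  have h5 : ((N + 1 : ℕ) : ℝ) ^ δ / δ ≤ 2 ^ δ * (N : ℝ) ^ δ / δ := by gcongr
  calc (harmonic (N + 1) : ℝ) ≤ (N : ℝ) ^ δ + 2 ^ δ * (N : ℝ) ^ δ / δ := by linarith
    _ = _ := by ring

theorem sum_ffun_mul_ffun_succ_eq {k : ℕ} (hk : k ≠ 0) (N : ℕ) :
    ∑ n ∈ Finset.Icc 1 N, ffun k n * ffun k (n + 1) =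
      ∑ p ∈ Finset.Icc 1 (N + 1) ×ˢ Finset.Icc 1 (N + 1),
        (moebius p.1 : ℝ) / (p.1 : ℝ) ^ k * ((moebius p.2 : ℝ) / (p.2 : ℝ) ^ k) *
          ((Finset.Icc 1 N).filter fun n => p.1 ^ k ∣ n ∧ p.2 ^ k ∣ n + 1).card := by
  have h : ∀ n ∈ Finset.Icc 1 N, ffun k n * ffun k (n + 1) =
      ∑ p ∈ Finset.Icc 1 (N + 1) ×ˢ Finset.Icc 1 (N + 1),
        (moebius p.1 : ℝ) / (p.1 : ℝ) ^ k * ((moebius p.2 : ℝ) / (p.2 : ℝ) ^ k) *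
          if p.1 ^ k ∣ n ∧ p.2 ^ k ∣ n + 1 then 1 else 0 := by
    intro n hn
    rw [Finset.mem_Icc] at hn
    rw [ffun_eq_sum_Icc (M := N + 1) hk (by omega) (by omega),
      ffun_eq_sum_Icc (M := N + 1) hk (by omega) (by omega), Finset.sum_mul_sum,
      Finset.sum_product]
    refine Finset.sum_congr rfl fun a _ => Finset.sum_congr rfl fun b _ => ?_
    by_cases h1 : a ^ k ∣ n <;> by_cases h2 : b ^ k ∣ n + 1 <;> simp [h1, h2]
  rw [Finset.sum_congr rfl h, Finset.sum_comm]
  refine Finset.sum_congr rfl fun p _ => ?_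
  rw [← Finset.mul_sum, Finset.sum_boole]

theorem abs_moebius_div_mul_card_sub_le {k : ℕ} (hk : k ≠ 0) (N : ℕ) {a b : ℕ} (ha : 1 ≤ a)
    (hb : 1 ≤ b) :
    |(moebius a : ℝ) / (a : ℝ) ^ k * ((moebius b : ℝ) / (b : ℝ) ^ k) *
        ((Finset.Icc 1 N).filter fun n => a ^ k ∣ n ∧ b ^ k ∣ n + 1).card -
      N * coprimeTerm k (a, b)| ≤ (a : ℝ)⁻¹ * (b : ℝ)⁻¹ := by
  by_cases hc : a.Coprime b
  · have hcard := abs_card_filter_dvd_dvd_succ_sub_le (pow_ne_zero k (by omega : a ≠ 0))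
      (pow_ne_zero k (by omega : b ≠ 0)) (hc.pow k k) N
    set q : ℕ := ((Finset.Icc 1 N).filter fun n => a ^ k ∣ n ∧ b ^ k ∣ n + 1).card
    have hle : ∀ m : ℕ, 1 ≤ m → |(moebius m : ℝ) / (m : ℝ) ^ k| ≤ (m : ℝ)⁻¹ := by
      intro m hm
      have hm' : (1 : ℝ) ≤ m := by exact_mod_cast hm
      rw [abs_div, inv_eq_one_div, abs_of_nonneg (by positivity : (0 : ℝ) ≤ (m : ℝ) ^ k)]
      exact div_le_div₀ zero_le_one (abs_moebius_le_one_real m) (by positivity)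
        (le_self_pow₀ hm' hk)
    have hmain : (moebius a : ℝ) / (a : ℝ) ^ k * ((moebius b : ℝ) / (b : ℝ) ^ k) * q -
        N * coprimeTerm k (a, b) = (moebius a : ℝ) / (a : ℝ) ^ k *
          ((moebius b : ℝ) / (b : ℝ) ^ k) * (q - N / (((a ^ k : ℕ) : ℝ) * ((b ^ k : ℕ) : ℝ))) := by
      simp only [coprimeTerm, if_pos hc]
      push_cast
      ring
    rw [hmain, abs_mul, abs_mul]
    calc _ ≤ (a : ℝ)⁻¹ * (b : ℝ)⁻¹ * 1 := by
          gcongr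
          · exact hle a ha
          · exact hle b hb
      _ = _ := mul_one _
  · rw [filter_dvd_dvd_succ_eq_empty (by rwa [Nat.coprime_pow_left_iff (Nat.pos_of_ne_zero hk),
      Nat.coprime_pow_right_iff (Nat.pos_of_ne_zero hk)])]
    simp only [coprimeTerm, if_neg hc, Finset.card_empty, Nat.cast_zero, mul_zero, sub_zero,
      abs_zero]
    positivity

/-- |∑_{1 ≤ n ≤ N} f_k(n)·f_k(n+1) − N·∏_p (1 − 2/p^{2k})| ≤ C·N^ε. -/
theorem sum_ffun_mul_ffun_succ_asymptotic (k : ℕ) (hk : 1 ≤ k) (ε : ℝ) (hε : 0 < ε) :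
    ∃ C : ℝ, 0 < C ∧ ∀ N : ℕ, 1 ≤ N →
      |(∑ n ∈ Finset.Icc 1 N, ffun k n * ffun k (n + 1))
          - (N : ℝ) * ∏' p : Nat.Primes, (1 - 2 / ((p : ℕ) : ℝ) ^ (2 * k))|
        ≤ C * (N : ℝ) ^ ε := by
  have hk0 : k ≠ 0 := by omega
  have hδ : 0 < ε / 2 := by positivity
  set D : ℝ := 1 + 2 ^ (ε / 2) / (ε / 2)
  set Z : ℝ := ∑' n : ℕ, ((n : ℝ) ^ 2)⁻¹
  have hD : 0 < D := by positivity
  have hZ : 0 ≤ Z := tsum_nonneg fun n => by positivity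
  refine ⟨D ^ 2 + 2 * Z, by positivity, fun N hN => ?_⟩
  rw [← tsum_coprimeTerm hk, sum_ffun_mul_ffun_succ_eq hk0]
  set s := Finset.Icc 1 (N + 1) ×ˢ Finset.Icc 1 (N + 1) with hs
  set S := ∑ p ∈ s, (moebius p.1 : ℝ) / (p.1 : ℝ) ^ k * ((moebius p.2 : ℝ) / (p.2 : ℝ) ^ k) *
    ((Finset.Icc 1 N).filter fun n => p.1 ^ k ∣ n ∧ p.2 ^ k ∣ n + 1).card with hS
  have hN' : (1 : ℝ) ≤ N := by exact_mod_cast hN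
  have hpow : (1 : ℝ) ≤ (N : ℝ) ^ ε := Real.one_le_rpow hN' hε.le
  have h1 : |S - N * ∑ p ∈ s, coprimeTerm k p| ≤ D ^ 2 * (N : ℝ) ^ ε := by
    rw [hS, Finset.mul_sum, ← Finset.sum_sub_distrib]
    calc _ ≤ ∑ p ∈ s, (p.1 : ℝ)⁻¹ * (p.2 : ℝ)⁻¹ := by
          refine (Finset.abs_sum_le_sum_abs _ _).trans (Finset.sum_le_sum fun p hp => ?_)
          simp only [hs, Finset.mem_product, Finset.mem_Icc] at hp
          exact abs_moebius_div_mul_card_sub_le hk0 N hp.1.1 hp.2.1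
      _ = (harmonic (N + 1) : ℝ) ^ 2 := by
          rw [hs, Finset.sum_product, sq, ← sum_Icc_inv_eq_harmonic, Finset.sum_mul_sum]
      _ ≤ (D * (N : ℝ) ^ (ε / 2)) ^ 2 := by
          have h0 : (0 : ℝ) ≤ harmonic (N + 1) := by
            rw [← sum_Icc_inv_eq_harmonic]
            positivity
          exact pow_le_pow_left₀ h0 (harmonic_succ_le_rpow hδ hN) 2
      _ = D ^ 2 * (N : ℝ) ^ ε := by
          rw [mul_pow, ← Real.rpow_mul_natCast (by positivity)]
          congr 2
          push_cast
          ring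
  have h2 : |N * (∑' p, coprimeTerm k p - ∑ p ∈ s, coprimeTerm k p)| ≤ 2 * Z * (N : ℝ) ^ ε := by
    rw [abs_mul, Nat.abs_cast]
    have h3 := abs_tsum_coprimeTerm_sub_sum_le hk (Nat.succ_ne_zero N)
    have h4 : (N : ℝ) * ((N.succ : ℕ) : ℝ)⁻¹ ≤ 1 := by
      rw [← div_eq_mul_inv, div_le_one (by positivity)]
      exact_mod_cast Nat.le_succ N
    calc _ ≤ (N : ℝ) * (2 * Z * ((N.succ : ℕ) : ℝ)⁻¹) := by gcongr
      _ = 2 * Z * ((N : ℝ) * ((N.succ : ℕ) : ℝ)⁻¹) := by ring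
      _ ≤ 2 * Z * (N : ℝ) ^ ε := by gcongr; exact h4.trans hpow
  rw [abs_le] at h1 h2 ⊢
  constructor <;> linarith
end

section
/- Fix α ∈ (0,1) and an integer k ≥ 1. There exists a constant C = C(α) > 0 such that for all integers a, b, n with b, n ≥ 1, | ∑_{0 ≤ m ≤ n, gcd(m+a, b) is k-free} C_α(n,m) − f_k(b) | ≤ C·τ₃(b)/√n. -/
open scoped BigOperators Classical

/-- The binomial probability `C_α(n,s) = binom(n,s) · α^s · (1-α)^(n-s)`. -/
noncomputable def binomProb (α : ℝ) (n s : ℕ) : ℝ :=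
  (n.choose s : ℝ) * α ^ s * (1 - α) ^ (n - s)

/-- The 3-fold divisor function: the number of ordered triples `(d₁, d₂, d₃)` of
positive integers with `d₁ * d₂ * d₃ = n`. -/
def tau3 (n : ℕ) : ℕ := ∑ d ∈ n.divisors, (n / d).divisors.card

/-- The binomial probabilities shifted by one, with value `0` in front. -/
noncomputable def shiftedBinomProb (α : ℝ) (n : ℕ) : ℕ → ℝ
  | 0 => 0
  | m + 1 => binomProb α n m

theorem binomProb_eq_zero_of_lt (α : ℝ) {n m : ℕ} (h : n < m) : binomProb α n m = 0 := by
  simp [binomProb, Nat.choose_eq_zero_of_lt h]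

theorem binomProb_nonneg {α : ℝ} (hα : α ∈ Set.Ioo (0 : ℝ) 1) (n m : ℕ) :
    0 ≤ binomProb α n m := by
  have h0 := hα.1.le
  have h1 : 0 ≤ 1 - α := by linarith [hα.2]
  unfold binomProb
  positivity

theorem binomProb_eq_eval (α : ℝ) (n m : ℕ) :
    binomProb α n m = (bernsteinPolynomial ℝ n m).eval α := by
  simp [binomProb, bernsteinPolynomial]

theorem sum_binomProb (α : ℝ) (n : ℕ) :
    ∑ m ∈ Finset.range (n + 1), binomProb α n m = 1 := by
  have h := congrArg (Polynomial.eval α) (bernsteinPolynomial.sum ℝ n)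
  simpa [Polynomial.eval_finsetSum, binomProb_eq_eval] using h

theorem sum_sq_mul_binomProb (α : ℝ) (n : ℕ) :
    ∑ m ∈ Finset.range (n + 1), ((n : ℝ) * α - m) ^ 2 * binomProb α n m
      = n * α * (1 - α) := by
  have h := congrArg (Polynomial.eval α) (bernsteinPolynomial.variance ℝ n)
  simpa [Polynomial.eval_finsetSum, binomProb_eq_eval] using h

theorem sum_abs_mul_binomProb_le {α : ℝ} (hα : α ∈ Set.Ioo (0 : ℝ) 1) (n : ℕ) :
    ∑ m ∈ Finset.range (n + 1), |(n : ℝ) * α - m| * binomProb α n m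
      ≤ √(n * α * (1 - α)) := by
  refine Real.le_sqrt_of_sq_le ?_
  have h := Finset.sum_sq_le_sum_mul_sum_of_sq_le_mul (Finset.range (n + 1))
    (r := fun m : ℕ => |(n : ℝ) * α - m| * binomProb α n m)
    (f := fun m : ℕ => ((n : ℝ) * α - m) ^ 2 * binomProb α n m)
    (g := fun m : ℕ => binomProb α n m)
    (fun m _ => mul_nonneg (sq_nonneg _) (binomProb_nonneg hα n m))
    (fun m _ => binomProb_nonneg hα n m)
    (fun m _ => by rw [mul_pow, sq_abs, mul_assoc, ← sq])
  rwa [sum_binomProb, sum_sq_mul_binomProb, mul_one] at h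

theorem binomProb_succ_mul_sub (α : ℝ) (n m : ℕ) :
    ((n : ℝ) + 1) * (α * (1 - α)) * (shiftedBinomProb α n (m + 1) - shiftedBinomProb α n m)
      = (((n + 1 : ℕ) : ℝ) * α - m) * binomProb α (n + 1) m := by
  have up : ∀ j, ((n : ℝ) + 1) * (1 - α) * binomProb α n j
      = ((n : ℝ) + 1 - j) * binomProb α (n + 1) j := by
    intro j
    rcases lt_or_ge n j with h | h
    · rw [binomProb_eq_zero_of_lt α h]
      rcases eq_or_lt_of_le (Nat.succ_le_of_lt h) with h' | h'
      · simp [← h']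
      · rw [binomProb_eq_zero_of_lt α h']; ring
    · have hc := Nat.add_one_mul_choose_eq n (n - j)
      rw [Nat.choose_symm h, show n - j + 1 = n + 1 - j by omega,
        Nat.choose_symm (by omega : j ≤ n + 1)] at hc
      have hc' : ((n : ℝ) + 1) * n.choose j = (n + 1).choose j * ((n : ℝ) + 1 - j) := by
        have := congrArg (Nat.cast (R := ℝ)) hc
        push_cast [Nat.cast_sub (by omega : j ≤ n + 1)] at this
        exact this
      unfold binomProb
      rw [show n + 1 - j = (n - j) + 1 by omega, pow_succ]
      linear_combination (α ^ j * (1 - α) ^ (n - j) * (1 - α)) * hc'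
  have down : ∀ j : ℕ, ((n : ℝ) + 1) * α * binomProb α n j
      = ((j : ℝ) + 1) * binomProb α (n + 1) (j + 1) := by
    intro j
    have hc : ((n : ℝ) + 1) * n.choose j = (n + 1).choose (j + 1) * ((j : ℝ) + 1) := by
      exact_mod_cast Nat.add_one_mul_choose_eq n j
    unfold binomProb
    rw [Nat.add_sub_add_right, pow_succ]
    linear_combination (α ^ j * α * (1 - α) ^ (n - j)) * hc
  cases m with
  | zero =>
    have := up 0
    simp only [shiftedBinomProb]
    push_cast at this ⊢
    linear_combination α * this
  | succ j =>
    have h1 := up (j + 1)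
    have h2 := down j
    simp only [shiftedBinomProb]
    push_cast at h1 ⊢
    linear_combination α * h1 - (1 - α) * h2

theorem sum_abs_shiftedBinomProb_sub_le {α : ℝ} (hα : α ∈ Set.Ioo (0 : ℝ) 1) (n M : ℕ) :
    ∑ m ∈ Finset.range M, |shiftedBinomProb α n (m + 1) - shiftedBinomProb α n m|
      ≤ 1 / √(((n : ℝ) + 1) * α * (1 - α)) := by
  have hc : 0 < ((n : ℝ) + 1) * α * (1 - α) := by
    have h0 := hα.1
    have h1 : 0 < 1 - α := by linarith [hα.2]
    positivity
  generalize hcdef : ((n : ℝ) + 1) * α * (1 - α) = c at hc ⊢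
  have hterm : ∀ m : ℕ, |shiftedBinomProb α n (m + 1) - shiftedBinomProb α n m|
      = |((n + 1 : ℕ) : ℝ) * α - m| * binomProb α (n + 1) m / c := by
    intro m
    have h := congrArg abs (binomProb_succ_mul_sub α n m)
    rw [← mul_assoc, hcdef, abs_mul c, abs_mul, abs_of_pos hc,
      abs_of_nonneg (binomProb_nonneg hα _ _)] at h
    rw [← h]
    field_simp
  simp_rw [hterm]
  rw [← Finset.sum_div]
  have hle : ∑ m ∈ Finset.range M, |((n + 1 : ℕ) : ℝ) * α - m| * binomProb α (n + 1) m ≤ √c := by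
    calc _ ≤ ∑ m ∈ Finset.range (n + 1 + 1),
            |((n + 1 : ℕ) : ℝ) * α - m| * binomProb α (n + 1) m := by
          rw [← Finset.sum_filter_add_sum_filter_not (Finset.range M) (fun m => m < n + 1 + 1)]
          rw [Finset.sum_eq_zero (s := (Finset.range M).filter (fun m => ¬ m < n + 1 + 1)), add_zero]
          · refine Finset.sum_le_sum_of_subset_of_nonneg ?_ ?_
            · intro m hm
              exact Finset.mem_range.2 (Finset.mem_filter.1 hm).2
            · intro m _ _
              exact mul_nonneg (abs_nonneg _) (binomProb_nonneg hα _ _)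
          · intro m hm
            rw [binomProb_eq_zero_of_lt α (by have := (Finset.mem_filter.1 hm).2; omega), mul_zero]
      _ ≤ _ := by
          have := sum_abs_mul_binomProb_le hα (n + 1)
          rw [← hcdef]
          push_cast at this ⊢
          exact this
  calc _ ≤ √c / c := by gcongr
    _ = 1 / √c := by
      rw [Real.sqrt_div_self', one_div]

/-- Sampling a sequence along multiples of `w` compares with its mean up to its variation. -/
theorem abs_mul_sum_multiples_sub_sum_le (g : ℕ → ℝ) {w : ℕ} (hw : 0 < w) (T : ℕ) :
    |(w : ℝ) * (∑ i ∈ Finset.range (w * T), if w ∣ i then g i else 0)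
        - ∑ i ∈ Finset.range (w * T), g i|
      ≤ w * ∑ i ∈ Finset.range (w * T), |g (i + 1) - g i| := by
  induction T with
  | zero => simp
  | succ T ih =>
    rw [Nat.mul_succ, Finset.sum_range_add, Finset.sum_range_add, Finset.sum_range_add]
    have hblock : ∑ j ∈ Finset.range w, (if w ∣ w * T + j then g (w * T + j) else 0)
        = g (w * T) := by
      rw [Finset.sum_eq_single_of_mem 0 (Finset.mem_range.2 hw)]
      · simp
      · intro j hj hj0
        rw [if_neg]
        rw [Nat.dvd_add_right (Dvd.intro _ rfl)]
        exact fun h => absurd (Nat.le_of_dvd (Nat.pos_of_ne_zero hj0) h)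
          (not_le.2 (Finset.mem_range.1 hj))
    have hj : ∀ j ∈ Finset.range w, |g (w * T) - g (w * T + j)|
        ≤ ∑ i ∈ Finset.range w, |g (w * T + i + 1) - g (w * T + i)| := by
      intro j hj
      have htel := Finset.sum_range_sub (fun i => g (w * T + i)) j
      rw [abs_sub_comm]
      calc _ = |∑ i ∈ Finset.range j, (g (w * T + i + 1) - g (w * T + i))| := by
            simpa [add_assoc] using congrArg abs htel.symm
        _ ≤ ∑ i ∈ Finset.range j, |g (w * T + i + 1) - g (w * T + i)| :=
            Finset.abs_sum_le_sum_abs _ _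
        _ ≤ _ := Finset.sum_le_sum_of_subset_of_nonneg
            (Finset.range_subset_range.2 (Finset.mem_range.1 hj).le) (fun _ _ _ => abs_nonneg _)
    have hb : |(w : ℝ) * g (w * T) - ∑ j ∈ Finset.range w, g (w * T + j)|
        ≤ w * ∑ i ∈ Finset.range w, |g (w * T + i + 1) - g (w * T + i)| := by
      calc _ = |∑ j ∈ Finset.range w, (g (w * T) - g (w * T + j))| := by
            simp [Finset.sum_sub_distrib]
        _ ≤ ∑ j ∈ Finset.range w, |g (w * T) - g (w * T + j)| := Finset.abs_sum_le_sum_abs _ _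
        _ ≤ _ := by
            simpa using Finset.sum_le_card_nsmul _ _ _ hj
    rw [hblock, mul_add, mul_add, add_sub_add_comm]
    exact (abs_add_le _ _).trans (add_le_add ih hb)

theorem sum_abs_translate_sub_le (u : ℕ → ℝ) (s N : ℕ) :
    ∑ i ∈ Finset.range N, |u (i + 1 + 1 - s) - u (i + 1 - s)|
      ≤ ∑ m ∈ Finset.range (N + 1 - s), |u (m + 1) - u m| := by
  induction N with
  | zero => simpa using Finset.sum_nonneg (fun _ _ => abs_nonneg _)
  | succ N ih =>
    rw [Finset.sum_range_succ]
    rcases le_or_gt s (N + 1) with h | h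
    · rw [show N + 1 + 1 - s = (N + 1 - s) + 1 by omega, Finset.sum_range_succ]
      gcongr
    · have e1 : N + 1 + 1 - s = 0 := by omega
      have e2 : N + 1 - s = 0 := by omega
      rw [e2] at ih
      rw [e1, e2]
      simpa using ih

theorem sum_translate_shiftedBinomProb (α : ℝ) (n s K : ℕ) (hK : s + (n + 1) ≤ K)
    (P : ℕ → Prop) [DecidablePred P] :
    ∑ i ∈ Finset.range K, (if P i then shiftedBinomProb α n (i + 1 - s) else 0)
      = ∑ m ∈ (Finset.range (n + 1)).filter (fun m => P (m + s)), binomProb α n m := by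
  obtain ⟨e, rfl⟩ := Nat.exists_eq_add_of_le hK
  rw [Finset.sum_range_add, Finset.sum_range_add, Finset.sum_filter,
    Finset.sum_eq_zero (s := Finset.range s), Finset.sum_eq_zero (s := Finset.range e)]
  · rw [zero_add, add_zero]
    refine Finset.sum_congr rfl fun m _ => ?_
    rw [show s + m + 1 - s = m + 1 by omega, add_comm s m]
    rfl
  · intro i _
    rw [show s + (n + 1) + i + 1 - s = (n + 1 + i) + 1 by omega]
    simp [shiftedBinomProb, binomProb_eq_zero_of_lt α (show n < n + 1 + i by omega)]
  · intro i hi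
    rw [show i + 1 - s = 0 by have := Finset.mem_range.1 hi; omega]
    simp [shiftedBinomProb]

/-- Equidistribution of the binomial distribution in residue classes, uniformly in the modulus. -/
theorem abs_sum_binomProb_residue_sub_le {α : ℝ} (hα : α ∈ Set.Ioo (0 : ℝ) 1) (n : ℕ) (a : ℤ)
    {w : ℕ} (hw : 0 < w) :
    |∑ m ∈ (Finset.range (n + 1)).filter (fun m : ℕ => (w : ℤ) ∣ (m : ℤ) + a), binomProb α n m
        - 1 / w| ≤ 1 / √(((n : ℝ) + 1) * α * (1 - α)) := by
  have hw' : (0 : ℝ) < w := by exact_mod_cast hw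
  obtain ⟨s, hs⟩ := Int.eq_ofNat_of_zero_le (Int.emod_nonneg a (by omega : (w : ℤ) ≠ 0))
  have hdvd : ∀ m : ℕ, (w : ℤ) ∣ (m : ℤ) + a ↔ w ∣ m + s := by
    intro m
    rw [← Int.natCast_dvd_natCast]
    push_cast
    rw [← hs, ← Int.emod_add_mul_ediv a w, ← add_assoc, dvd_add_left (Dvd.intro _ rfl)]
    simp
  have hK : s + (n + 1) ≤ w * (s + (n + 1)) := Nat.le_mul_of_pos_left _ hw
  have key := abs_mul_sum_multiples_sub_sum_le
    (fun i => shiftedBinomProb α n (i + 1 - s)) hw (s + (n + 1))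
  have htot := sum_translate_shiftedBinomProb α n s _ hK (fun _ => True)
  simp only [if_true, Finset.filter_true, sum_binomProb] at htot
  have hres := sum_translate_shiftedBinomProb α n s _ hK (fun i => w ∣ i)
  have hvar := (sum_abs_translate_sub_le (shiftedBinomProb α n) s (w * (s + (n + 1)))).trans
    (sum_abs_shiftedBinomProb_sub_le hα n _)
  rw [Finset.sum_congr (Finset.filter_congr fun m _ => hdvd m) fun _ _ => rfl, ← hres]
  rw [htot] at key
  refine le_of_mul_le_mul_left ?_ hw'
  calc _ = |(w : ℝ) * (∑ i ∈ Finset.range (w * (s + (n + 1))),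
          if w ∣ i then shiftedBinomProb α n (i + 1 - s) else 0) - 1| := by
        rw [← abs_of_pos hw', ← abs_mul, abs_of_pos hw', mul_sub, mul_one_div_cancel hw'.ne']
    _ ≤ _ := key.trans (mul_le_mul_of_nonneg_left hvar hw'.le)

/-- The Dirichlet convolution of `μ` with the indicator function of the `k`-free numbers. -/
noncomputable def kfreeWeight (k w : ℕ) : ℝ :=
  ∑ rd ∈ w.divisorsAntidiagonal,
    (ArithmeticFunction.moebius rd.1 : ℝ) * if KFree k rd.2 then 1 else 0

theorem sum_divisors_kfreeWeight (k : ℕ) {g : ℕ} (hg : 0 < g) :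
    ∑ w ∈ g.divisors, kfreeWeight k w = if KFree k g then 1 else 0 :=
  (ArithmeticFunction.sum_eq_iff_sum_mul_moebius_eq (f := kfreeWeight k)
    (g := fun m => if KFree k m then (1 : ℝ) else 0)).2 (fun _ _ => rfl) g hg

theorem abs_kfreeWeight_le (k w : ℕ) : |kfreeWeight k w| ≤ w.divisors.card := by
  calc |kfreeWeight k w| ≤ ∑ rd ∈ w.divisorsAntidiagonal,
        |(ArithmeticFunction.moebius rd.1 : ℝ) * if KFree k rd.2 then 1 else 0| :=
        Finset.abs_sum_le_sum_abs _ _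
    _ ≤ ∑ rd ∈ w.divisorsAntidiagonal, 1 := by
        refine Finset.sum_le_sum fun rd _ => ?_
        have h : |(ArithmeticFunction.moebius rd.1 : ℝ)| ≤ 1 := by
          exact_mod_cast ArithmeticFunction.abs_moebius_le_one
        split_ifs
        · simpa using h
        · simp
    _ = _ := by
        rw [← Nat.map_div_right_divisors]
        simp

theorem ffun_eq_sum_kfreeWeight (k b : ℕ) :
    ffun k b = ∑ w ∈ b.divisors, kfreeWeight k w * (1 / w) := by
  refine Finset.sum_congr rfl fun w _ => ?_
  rw [kfreeWeight, Finset.sum_mul]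
  refine Finset.sum_congr rfl fun rd hrd => ?_
  rw [← (Nat.mem_divisorsAntidiagonal.1 hrd).1]
  split_ifs
  · push_cast; ring
  · simp

theorem sum_divisors_card_divisors (b : ℕ) :
    ∑ w ∈ b.divisors, (w.divisors.card : ℝ) = tau3 b := by
  rw [tau3, Nat.sum_div_divisors b (fun d => d.divisors.card)]
  push_cast
  rfl

theorem sum_kfree_gcd_eq (k : ℕ) (p : ℕ → ℝ) (a : ℤ) {b : ℕ} (hb : 1 ≤ b) (s : Finset ℕ) :
    ∑ m ∈ s.filter (fun m : ℕ => KFree k (Int.gcd ((m : ℤ) + a) (b : ℤ))), p m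
      = ∑ w ∈ b.divisors, kfreeWeight k w *
          ∑ m ∈ s.filter (fun m : ℕ => (w : ℤ) ∣ (m : ℤ) + a), p m := by
  simp_rw [Finset.mul_sum, Finset.sum_filter]
  rw [Finset.sum_comm]
  refine Finset.sum_congr rfl fun m _ => ?_
  have hdiv : (Int.gcd ((m : ℤ) + a) (b : ℤ)).divisors
      = b.divisors.filter (fun w : ℕ => (w : ℤ) ∣ (m : ℤ) + a) := by
    ext w
    simp only [Nat.mem_divisors, Finset.mem_filter, Int.dvd_gcd_iff, ne_eq, Int.gcd_eq_zero_iff,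
      Int.natCast_dvd_natCast]
    grind
  have h := sum_divisors_kfreeWeight k
    (Int.gcd_pos_of_ne_zero_right ((m : ℤ) + a) (by omega : (b : ℤ) ≠ 0))
  rw [hdiv, Finset.sum_filter] at h
  calc _ = (if KFree k (Int.gcd ((m : ℤ) + a) (b : ℤ)) then 1 else 0) * p m := by simp
    _ = _ := by
      rw [← h, Finset.sum_mul]
      exact Finset.sum_congr rfl fun w _ => by split_ifs <;> simp

/-- | ∑_{0 ≤ m ≤ n, gcd(m+a,b) is k-free} C_α(n,m) − f_k(b) | ≤ C·τ₃(b)/√n. -/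
theorem binomial_sum_kfree_gcd (α : ℝ) (hα : α ∈ Set.Ioo (0 : ℝ) 1) (k : ℕ) (hk : 1 ≤ k) :
    ∃ C : ℝ, 0 < C ∧ ∀ (a : ℤ) (b n : ℕ), 1 ≤ b → 1 ≤ n →
      |(∑ m ∈ (Finset.range (n + 1)).filter
            (fun m : ℕ => KFree k (Int.gcd ((m : ℤ) + a) (b : ℤ))),
          binomProb α n m) - ffun k b|
        ≤ C * (tau3 b : ℝ) / Real.sqrt n := by
  have hv : 0 < α * (1 - α) := mul_pos hα.1 (by linarith [hα.2])
  refine ⟨1 / √(α * (1 - α)), by positivity, fun a b n hb hn => ?_⟩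
  have hn' : (0 : ℝ) < n := by exact_mod_cast hn
  have hbound : 1 / √(((n : ℝ) + 1) * α * (1 - α)) ≤ 1 / √(α * (1 - α)) / √n := by
    rw [div_div, ← Real.sqrt_mul hv.le]
    refine one_div_le_one_div_of_le (by positivity) (Real.sqrt_le_sqrt ?_)
    nlinarith
  rw [sum_kfree_gcd_eq k _ a hb, ffun_eq_sum_kfreeWeight, ← Finset.sum_sub_distrib]
  simp_rw [← mul_sub]
  calc _ ≤ ∑ w ∈ b.divisors, |kfreeWeight k w * (∑ m ∈ (Finset.range (n + 1)).filter
          (fun m : ℕ => (w : ℤ) ∣ (m : ℤ) + a), binomProb α n m - 1 / w)| :=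
        Finset.abs_sum_le_sum_abs _ _
    _ ≤ ∑ w ∈ b.divisors, (w.divisors.card : ℝ) * (1 / √(α * (1 - α)) / √n) := by
        refine Finset.sum_le_sum fun w hw => ?_
        rw [abs_mul]
        exact mul_le_mul (abs_kfreeWeight_le k w)
          ((abs_sum_binomProb_residue_sub_le hα n a (Nat.pos_of_mem_divisors hw)).trans hbound)
          (abs_nonneg _) (Nat.cast_nonneg _)
    _ = _ := by
        rw [← Finset.sum_mul, sum_divisors_card_divisors]
        ring
end

section
/- Fix an integer k ≥ 1. The series ∑_{n=1}^{∞} g_k(n)·τ*(n)/n² converges to ∏_p (1 − 2/p^{2k}), where the product is over all primes p. -/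
open scoped BigOperators Classical

/-- `g k n = ∑ μ(r)` over pairs `(r, d)` of positive integers with `r * d = n` and `d` k-free. -/
noncomputable def gfun (k n : ℕ) : ℤ :=
  ∑ rd ∈ n.divisorsAntidiagonal,
    if KFree k rd.2 then ArithmeticFunction.moebius rd.1 else 0

/-- The unitary divisor function: the number of ordered pairs `(n₁, n₂)` of positive
integers with `n₁ * n₂ = n` and `gcd(n₁, n₂) = 1`. -/
def tauStar (n : ℕ) : ℕ :=
  (n.divisorsAntidiagonal.filter fun p => Nat.Coprime p.1 p.2).card

theorem kFree_mul_iff {k m n : ℕ} (hk : k ≠ 0) (hmn : m.Coprime n) :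
    KFree k (m * n) ↔ KFree k m ∧ KFree k n := by
  simp only [KFree, ← forall_and, ← not_or]
  refine forall₂_congr fun p hp => not_congr ?_
  exact hmn.isPrimePow_dvd_mul (hp.isPrimePow.pow hk)

theorem kFree_prime_pow_iff {k p e : ℕ} (hk : k ≠ 0) (hp : p.Prime) :
    KFree k (p ^ e) ↔ e < k := by
  refine ⟨fun h => ?_, fun h q hq hqd => ?_⟩
  · by_contra! hle
    exact h p hp (pow_dvd_pow p hle)
  · obtain rfl : q = p :=
      (Nat.prime_dvd_prime_iff_eq hq hp).1 (hq.dvd_of_dvd_pow ((dvd_pow_self q hk).trans hqd))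
    exact absurd ((Nat.pow_dvd_pow_iff_le_right hp.one_lt).1 hqd) (by omega)

/-- The indicator function of the `k`-free positive integers. -/
noncomputable def kFreeIndicator (k : ℕ) : ArithmeticFunction ℤ :=
  ⟨fun n => if n ≠ 0 ∧ KFree k n then 1 else 0, by simp⟩

theorem kFreeIndicator_apply {k n : ℕ} (hn : n ≠ 0) :
    kFreeIndicator k n = if KFree k n then 1 else 0 := by
  simp [kFreeIndicator, hn]

theorem isMultiplicative_kFreeIndicator {k : ℕ} (hk : k ≠ 0) :
    (kFreeIndicator k).IsMultiplicative := by
  rw [ArithmeticFunction.IsMultiplicative.iff_ne_zero]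
  refine ⟨?_, fun {m n} hm hn hmn => ?_⟩
  · have h : KFree k 1 := fun p hp hd => hp.one_lt.ne' (by simpa [hk] using hd)
    simp [kFreeIndicator_apply, h]
  · rw [kFreeIndicator_apply (mul_ne_zero hm hn), kFreeIndicator_apply hm, kFreeIndicator_apply hn,
      ite_zero_mul_ite_zero, mul_one]
    simp only [kFree_mul_iff hk hmn]

theorem moebius_mul_kFreeIndicator_apply (k n : ℕ) :
    (ArithmeticFunction.moebius * kFreeIndicator k) n = gfun k n := by
  rw [ArithmeticFunction.mul_apply, gfun]
  refine Finset.sum_congr rfl fun x hx => ?_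
  rw [kFreeIndicator_apply (Nat.ne_zero_of_mem_divisorsAntidiagonal hx).2]
  simp

theorem isMultiplicative_moebius_mul_kFreeIndicator {k : ℕ} (hk : k ≠ 0) :
    (ArithmeticFunction.moebius * kFreeIndicator k).IsMultiplicative :=
  ArithmeticFunction.isMultiplicative_moebius.mul (isMultiplicative_kFreeIndicator hk)

theorem gfun_prime_pow {k p : ℕ} (e : ℕ) (hk : k ≠ 0) (hp : p.Prime) :
    gfun k (p ^ e) = if e = 0 then 1 else if e = k then -1 else 0 := by
  rw [gfun, Nat.sum_divisorsAntidiagonal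
    (fun r d => if KFree k d then ArithmeticFunction.moebius r else 0),
    Nat.sum_divisors_prime_pow hp]
  have h : ∀ i ∈ Finset.range (e + 1),
      (if KFree k (p ^ e / p ^ i) then ArithmeticFunction.moebius (p ^ i) else 0) =
        (if i = 0 then if e < k then 1 else 0 else 0) +
          (if i = 1 then if e - 1 < k then -1 else 0 else 0) := by
    intro i hi
    rw [Nat.pow_div (by simpa [Nat.lt_succ_iff] using hi) hp.pos, kFree_prime_pow_iff hk hp]
    rcases eq_or_ne i 0 with rfl | hi0
    · simp
    · rw [ArithmeticFunction.moebius_apply_prime_pow hp hi0]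
      rcases eq_or_ne i 1 with rfl | hi1 <;> simp [*]
  rw [Finset.sum_congr rfl h, Finset.sum_add_distrib, Finset.sum_ite_eq', Finset.sum_ite_eq']
  simp only [Finset.mem_range]
  split_ifs <;> omega

theorem abs_gfun_le_one {k : ℕ} (n : ℕ) (hk : k ≠ 0) : |gfun k n| ≤ 1 := by
  rcases eq_or_ne n 0 with rfl | hn
  · simp [gfun]
  rw [← moebius_mul_kFreeIndicator_apply,
    (isMultiplicative_moebius_mul_kFreeIndicator hk).multiplicative_factorization _ hn,
    Finsupp.prod, Finset.abs_prod]
  refine Finset.prod_le_one (fun _ _ => abs_nonneg _) fun p hp => ?_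
  rw [moebius_mul_kFreeIndicator_apply, gfun_prime_pow _ hk (Nat.prime_of_mem_primeFactors hp)]
  split_ifs <;> simp

theorem tauStar_mul {m n : ℕ} (hmn : m.Coprime n) :
    tauStar (m * n) = tauStar m * tauStar n := by
  rw [tauStar, tauStar, tauStar, ← Finset.card_product]
  symm
  refine Finset.card_nbij' (fun x => (x.1.1 * x.2.1, x.1.2 * x.2.2))
    (fun y => ((y.1.gcd m, y.2.gcd m), (y.1.gcd n, y.2.gcd n))) ?_ ?_ ?_ ?_
  · rintro ⟨⟨a, a'⟩, ⟨b, b'⟩⟩ h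
    simp only [Finset.coe_product, Finset.coe_filter, Nat.mem_divisorsAntidiagonal, Set.mem_prod,
      Set.mem_ofPred_eq] at h ⊢
    obtain ⟨⟨⟨rfl, ha⟩, hc⟩, ⟨rfl, hb⟩, hd⟩ := h
    refine ⟨⟨by ring, mul_ne_zero ha hb⟩, ?_⟩
    simp only [Nat.coprime_mul_iff_left, Nat.coprime_mul_iff_right] at hmn ⊢
    exact ⟨⟨hc, hmn.1.2.symm⟩, hmn.2.1, hd⟩
  · rintro ⟨a, b⟩ h
    simp only [Finset.coe_product, Finset.coe_filter, Nat.mem_divisorsAntidiagonal, Set.mem_prod,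
      Set.mem_ofPred_eq] at h ⊢
    obtain ⟨⟨h, h0⟩, hc⟩ := h
    have h' : a * b = n * m := by rw [h, mul_comm]
    exact ⟨⟨⟨Nat.gcd_mul_gcd_of_coprime_of_mul_eq_mul hmn h, left_ne_zero_of_mul h0⟩,
        Nat.Coprime.of_dvd (Nat.gcd_dvd_left a m) (Nat.gcd_dvd_left b m) hc⟩,
      ⟨Nat.gcd_mul_gcd_of_coprime_of_mul_eq_mul hmn.symm h', right_ne_zero_of_mul h0⟩,
        Nat.Coprime.of_dvd (Nat.gcd_dvd_left a n) (Nat.gcd_dvd_left b n) hc⟩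
  · rintro ⟨⟨a, a'⟩, ⟨b, b'⟩⟩ h
    simp only [Finset.coe_product, Finset.coe_filter, Nat.mem_divisorsAntidiagonal, Set.mem_prod,
      Set.mem_ofPred_eq] at h ⊢
    obtain ⟨⟨⟨rfl, ha⟩, hc⟩, ⟨rfl, hb⟩, hd⟩ := h
    simp only [Nat.coprime_mul_iff_left, Nat.coprime_mul_iff_right] at hmn
    obtain ⟨⟨h11, h21⟩, h12, h22⟩ := hmn
    simp only [Prod.mk.injEq]
    refine ⟨⟨?_, ?_⟩, ?_, ?_⟩
    · rw [Nat.gcd_mul_left, h21.symm.gcd_eq_one, mul_one]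
    · rw [mul_comm a a', Nat.gcd_mul_left, h12.symm.gcd_eq_one, mul_one]
    · rw [mul_comm a b, Nat.gcd_mul_left, h12.gcd_eq_one, mul_one]
    · rw [mul_comm a' b', mul_comm b b', Nat.gcd_mul_left, h21.gcd_eq_one, mul_one]
  · rintro ⟨a, b⟩ h
    simp only [Finset.coe_filter, Nat.mem_divisorsAntidiagonal, Set.mem_ofPred_eq] at h
    simp only [← hmn.gcd_mul, ← h.1.1, Nat.gcd_mul_right_right, Nat.gcd_mul_left_right]

theorem tauStar_one : tauStar 1 = 1 := by
  simp [tauStar, Finset.filter_singleton]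

theorem tauStar_prime_pow {p e : ℕ} (hp : p.Prime) (he : e ≠ 0) : tauStar (p ^ e) = 2 := by
  have h1 : 1 < p ^ e := Nat.one_lt_pow he hp.one_lt
  have h : ((p ^ e).divisorsAntidiagonal.filter fun x => Nat.Coprime x.1 x.2) =
      {(1, p ^ e), (p ^ e, 1)} := by
    ext ⟨a, b⟩
    simp only [Finset.mem_filter, Nat.mem_divisorsAntidiagonal, Finset.mem_insert,
      Finset.mem_singleton, Prod.mk.injEq]
    constructor
    · rintro ⟨⟨hab, -⟩, hc⟩
      have hd : p ^ e ∣ a * b := hab.symm.dvd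
      rw [hc.isPrimePow_dvd_mul (hp.isPrimePow.pow he)] at hd
      rcases hd with hd | hd
      · have := Nat.dvd_antisymm hd (Dvd.intro _ hab)
        subst this
        exact Or.inr ⟨rfl, by simpa [hp.ne_zero] using hab⟩
      · have := Nat.dvd_antisymm hd (Dvd.intro_left _ hab)
        subst this
        exact Or.inl ⟨by simpa [hp.ne_zero] using hab, rfl⟩
    · rintro (⟨rfl, rfl⟩ | ⟨rfl, rfl⟩) <;> simp [hp.ne_zero]
  rw [tauStar]
  convert Finset.card_pair (a := (1, p ^ e)) (b := (p ^ e, 1)) (by simp [h1.ne]) using 2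

theorem tauStar_le_card_divisors (n : ℕ) : tauStar n ≤ n.divisors.card := by
  refine (Finset.card_filter_le _ _).trans_eq ?_
  rw [← Nat.map_div_right_divisors, Finset.card_map]

theorem summable_card_divisors_div_sq :
    Summable fun n : ℕ => (n.divisors.card : ℝ) / (n : ℝ) ^ 2 := by
  have hz : LSeriesSummable (fun n => (ArithmeticFunction.zeta : ArithmeticFunction ℂ) n) 2 := by
    simpa using! ArithmeticFunction.LSeriesSummable_zeta_iff (s := 2).2 (by simp)
  refine (ArithmeticFunction.LSeriesSummable_mul hz hz).norm.congr fun n => ?_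
  rcases eq_or_ne n 0 with rfl | hn
  · simp
  · rw [LSeries.norm_term_eq]
    have h : ((ArithmeticFunction.zeta : ArithmeticFunction ℂ) * ArithmeticFunction.zeta) n =
        (n.divisors.card : ℂ) := by
      rw [ArithmeticFunction.coe_zeta_mul_apply, Finset.card_eq_sum_ones, Nat.cast_sum]
      refine Finset.sum_congr rfl fun d hd => ?_
      simp [(Nat.pos_of_mem_divisors hd).ne']
    rw [if_neg hn, h]
    simp

theorem summable_norm_gfun_mul_tauStar {k : ℕ} (hk : k ≠ 0) :
    Summable fun n : ℕ => ‖(gfun k n : ℝ) * (tauStar n : ℝ) / (n : ℝ) ^ 2‖ := by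
  refine summable_card_divisors_div_sq.of_nonneg_of_le (fun _ => norm_nonneg _) fun n => ?_
  rw [norm_div, norm_mul, norm_pow, Real.norm_natCast, Real.norm_natCast]
  gcongr
  have hg : ‖(gfun k n : ℝ)‖ ≤ 1 := by
    rw [Real.norm_eq_abs]
    exact_mod_cast abs_gfun_le_one n hk
  calc _ ≤ 1 * (tauStar n : ℝ) := by gcongr
    _ ≤ _ := by simpa using tauStar_le_card_divisors n

theorem tsum_gfun_mul_tauStar_prime_pow {k p : ℕ} (hk : k ≠ 0) (hp : p.Prime) :
    ∑' e : ℕ, (gfun k (p ^ e) : ℝ) * (tauStar (p ^ e) : ℝ) / ((p ^ e : ℕ) : ℝ) ^ 2 =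
      1 - 2 / (p : ℝ) ^ (2 * k) := by
  rw [tsum_eq_sum (s := {0, k}), Finset.sum_pair hk.symm, gfun_prime_pow 0 hk hp,
    gfun_prime_pow k hk hp, tauStar_prime_pow hp hk]
  · simp [hk, tauStar_one, ← pow_mul, mul_comm k 2]
    ring
  · intro e he
    simp only [Finset.mem_insert, Finset.mem_singleton, not_or] at he
    simp [gfun_prime_pow e hk hp, he.1, he.2]

/-- Fix an integer k ≥ 1. The series ∑_{n=1}^{∞} g_k(n)·τ*(n)/n² converges to
∏_p (1 − 2/p^{2k}). -/
theorem gfun_tauStar_series_eq (k : ℕ) (hk : 1 ≤ k) :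
    HasSum (fun n : ℕ+ => (gfun k n : ℝ) * (tauStar n : ℝ) / (n : ℝ) ^ 2)
      (∏' p : Nat.Primes, (1 - 2 / ((p : ℕ) : ℝ) ^ (2 * k))) := by
  have hk0 : k ≠ 0 := by omega
  set f : ℕ → ℝ := fun n => (gfun k n : ℝ) * (tauStar n : ℝ) / (n : ℝ) ^ 2 with hf
  have hg := isMultiplicative_moebius_mul_kFreeIndicator hk0
  have hsum : Summable (‖f ·‖) := summable_norm_gfun_mul_tauStar hk0
  have hf0 : f 0 = 0 := by simp [hf]
  have hf1 : f 1 = 1 := by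
    simp only [hf, tauStar_one, ← moebius_mul_kFreeIndicator_apply, hg.map_one]
    norm_num
  have hmul : ∀ {m n : ℕ}, m.Coprime n → f (m * n) = f m * f n := by
    intro m n hmn
    simp only [hf, tauStar_mul hmn, ← moebius_mul_kFreeIndicator_apply,
      hg.map_mul_of_coprime hmn, Nat.cast_mul, Int.cast_mul]
    rw [div_mul_div_comm]
    ring
  have hprod := (EulerProduct.eulerProduct_hasProd hf1 hmul hsum hf0).tprod_eq
  have hfactor : ∀ p : Nat.Primes, ∑' e, f ((p : ℕ) ^ e) = 1 - 2 / ((p : ℕ) : ℝ) ^ (2 * k) :=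
    fun p => tsum_gfun_mul_tauStar_prime_pow hk0 p.prop
  simp only [hfactor] at hprod
  rw [hprod]
  refine (Function.Injective.hasSum_iff PNat.coe_injective fun n hn => ?_).2
    hsum.of_norm.hasSum
  obtain rfl : n = 0 := by
    by_contra h
    exact hn ⟨⟨n, Nat.pos_of_ne_zero h⟩, rfl⟩
  exact hf0
end
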